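/- arXiv:1504.00002 — 2 statements merged into one kernel-verified Lean document; each statement's English description precedes it below -/
import Mathlib

section
/- Almost sure convergence of the normalized information functional (Lemma 3(vi) of the paper): under the stated assumptions, P-almost surely (1/T)∫₀^T φ(s)² R(s, X_s) ds → Φ·κ as T → ∞. -/
open Filter MeasureTheory

/-- The growth `exp (s ^ 3)` is beaten by `exp (s ^ 5)` at an exponential rate. -/
theorem exp_cube_le_exp_two_mul_exp_neg_mul_exp_pow_five {s : ℝ} (hs : 0 ≤ s) :
    Real.exp (s ^ 3) ≤ Real.exp 2 * Real.exp (-s) * Real.exp (s ^ 5) := by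
  rw [← Real.exp_add, ← Real.exp_add, Real.exp_le_exp]
  have h : 0 ≤ (s - 1) ^ 2 * ((s + 1) * (s ^ 2 + s + 1)) := by positivity
  nlinarith [sq_nonneg (s - 1)]

/-- The time averages over `[0, T]` of a function integrable on `(0, ∞)` tend to `0`. -/
theorem tendsto_one_div_mul_intervalIntegral_zero {f : ℝ → ℝ}
    (hf : IntegrableOn f (Set.Ioi 0)) :
    Tendsto (fun T : ℝ => (1 / T) * ∫ s in (0:ℝ)..T, f s) atTop (nhds 0) := by
  have h := intervalIntegral_tendsto_integral_Ioi 0 hf tendsto_id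
  have hinv : Tendsto (fun T : ℝ => 1 / T) atTop (nhds 0) := by
    simpa using tendsto_inv_atTop_zero (𝕜 := ℝ)
  simpa using hinv.mul h

/-- If the deviation `r - κ` is integrable on `(0, ∞)`, weighted time averages of `r` behave like
those of the constant `κ`. -/
theorem tendsto_weighted_average_of_integrableOn_sub {w r : ℝ → ℝ} {κ Φ B : ℝ}
    (hw : Continuous w) (hB : ∀ t, |w t| ≤ B)
    (hr : IntegrableOn (fun s => r s - κ) (Set.Ioi 0))
    (hΦ : Tendsto (fun T : ℝ => (1 / T) * ∫ s in (0:ℝ)..T, w s) atTop (nhds Φ)) :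
    Tendsto (fun T : ℝ => (1 / T) * ∫ s in (0:ℝ)..T, w s * r s) atTop (nhds (Φ * κ)) := by
  have hwr : IntegrableOn (fun s => w s * (r s - κ)) (Set.Ioi 0) :=
    hr.bdd_mul hw.aestronglyMeasurable (Eventually.of_forall hB)
  have hlim := (hΦ.mul_const κ).add (tendsto_one_div_mul_intervalIntegral_zero hwr)
  rw [add_zero] at hlim
  refine hlim.congr' ?_
  filter_upwards [eventually_ge_atTop 0] with T hT
  have hint : IntervalIntegrable (fun s => w s * (r s - κ)) volume 0 T :=
    (intervalIntegrable_iff_integrableOn_Ioc_of_le hT).2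
      (hwr.mono_set Set.Ioc_subset_Ioi_self)
  have hwκ : IntervalIntegrable (fun s => w s * κ) volume 0 T :=
    (hw.mul continuous_const).intervalIntegrable 0 T
  rw [mul_assoc, ← intervalIntegral.integral_mul_const, ← mul_add,
    ← intervalIntegral.integral_add hwκ hint]
  congr 2
  funext s
  ring

/-- Under the second-moment bound and the drift-ratio band, almost every path of
`R s (X s) - κ` is integrable on `(0, ∞)`. -/
theorem ae_integrableOn_ratio_sub_center
    {Ω : Type*} [MeasurableSpace Ω] (P : Measure Ω) [IsProbabilityMeasure P]
    {X : ℝ → Ω → ℝ} (hX : Measurable (Function.uncurry X)) {C : ℝ}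
    (hXint : ∀ s : ℝ, 0 ≤ s → Integrable (fun ω => (X s ω) ^ 2) P)
    (hX2 : ∀ s : ℝ, 0 ≤ s → (∫ ω, (X s ω) ^ 2 ∂P) ≤ C * Real.exp (s ^ 3))
    {R : ℝ → ℝ → ℝ} (hR : Measurable (Function.uncurry R))
    {κ M d : ℝ} (hM : 0 < M) (hd : 0 < d)
    (hband : ∀ s : ℝ, 0 ≤ s → ∀ x : ℝ,
      |R s x - κ| ≤ M * (1 + x ^ 2) / (d + Real.exp (s ^ 5))) :
    ∀ᵐ ω ∂P, IntegrableOn (fun s => R s (X s ω) - κ) (Set.Ioi 0) := by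
  have hmeas : Measurable (fun p : ℝ × Ω => R p.1 (X p.1 p.2) - κ) :=
    (hR.comp (measurable_fst.prodMk hX)).sub_const κ
  have hmaj : ∀ s : ℝ, 0 ≤ s →
      Integrable (fun ω => M * (1 + X s ω ^ 2) / (d + Real.exp (s ^ 5))) P := fun s hs =>
    (((integrable_const 1).add (hXint s hs)).const_mul M).div_const _
  have hsec : ∀ s : ℝ, 0 ≤ s → Integrable (fun ω => R s (X s ω) - κ) P := fun s hs =>
    (hmaj s hs).mono' (hmeas.comp measurable_prodMk_left).aestronglyMeasurable
      (Eventually.of_forall fun ω => hband s hs (X s ω))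
  have hnorm : ∀ s : ℝ, 0 ≤ s →
      ∫ ω, ‖R s (X s ω) - κ‖ ∂P ≤ M * (1 + C) * Real.exp 2 * Real.exp (-s) := by
    intro s hs
    have hpos : 0 < d + Real.exp (s ^ 5) := by positivity
    have hone : 1 ≤ Real.exp (s ^ 3) := Real.one_le_exp (by positivity)
    have hC : 0 ≤ C := nonneg_of_mul_nonneg_left
      ((integral_nonneg fun ω => sq_nonneg (X s ω)).trans (hX2 s hs)) (Real.exp_pos _)
    calc ∫ ω, ‖R s (X s ω) - κ‖ ∂P
        ≤ ∫ ω, M * (1 + X s ω ^ 2) / (d + Real.exp (s ^ 5)) ∂P :=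
          integral_mono (hsec s hs).norm (hmaj s hs) fun ω => hband s hs (X s ω)
      _ = M * (1 + ∫ ω, X s ω ^ 2 ∂P) / (d + Real.exp (s ^ 5)) := by
          rw [integral_div, integral_const_mul,
            integral_add (integrable_const 1) (hXint s hs)]
          simp
      _ ≤ M * (1 + C) * Real.exp 2 * Real.exp (-s) := by
          rw [div_le_iff₀ hpos]
          calc M * (1 + ∫ ω, X s ω ^ 2 ∂P)
              ≤ M * (Real.exp (s ^ 3) + C * Real.exp (s ^ 3)) := by
                gcongr
                exact hX2 s hs
            _ = M * (1 + C) * Real.exp (s ^ 3) := by ring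
            _ ≤ M * (1 + C) * (Real.exp 2 * Real.exp (-s) * Real.exp (s ^ 5)) := by
                gcongr
                exact exp_cube_le_exp_two_mul_exp_neg_mul_exp_pow_five hs
            _ = M * (1 + C) * Real.exp 2 * Real.exp (-s) * Real.exp (s ^ 5) := by ring
            _ ≤ M * (1 + C) * Real.exp 2 * Real.exp (-s) * (d + Real.exp (s ^ 5)) := by
                gcongr
                linarith
  have hprod : Integrable (fun p : ℝ × Ω => R p.1 (X p.1 p.2) - κ)
      ((volume.restrict (Set.Ioi 0)).prod P) := by
    refine (integrable_prod_iff hmeas.aestronglyMeasurable).2 ⟨?_, ?_⟩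
    · filter_upwards [ae_restrict_mem measurableSet_Ioi] with s hs
      exact hsec s (le_of_lt hs)
    · refine ((integrableOn_exp_neg_Ioi 0).const_mul (M * (1 + C) * Real.exp 2)).mono'
        hmeas.norm.aestronglyMeasurable.integral_prod_right' ?_
      filter_upwards [ae_restrict_mem measurableSet_Ioi] with s hs
      rw [Real.norm_of_nonneg (integral_nonneg fun ω => norm_nonneg _)]
      exact hnorm s (le_of_lt hs)
  exact hprod.prod_left_ae

/-- Lemma 3(vi) of the paper: almost sure convergence of the normalized
information functional: P-a.s., (1/T)∫₀^T φ(s)² R(s, X_s) ds → Φ·κ as T → ∞. -/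
theorem normalized_information_converges_almost_surely
    {Ω : Type*} [MeasurableSpace Ω] (P : Measure Ω) [IsProbabilityMeasure P]
    (X : ℝ → Ω → ℝ) (hX : Measurable (Function.uncurry X))
    (C : ℝ) (hC : 0 < C)
    (hXint : ∀ s : ℝ, 0 ≤ s → Integrable (fun ω => (X s ω) ^ 2) P)
    (hX2 : ∀ s : ℝ, 0 ≤ s → (∫ ω, (X s ω) ^ 2 ∂P) ≤ C * Real.exp (s ^ 3))
    (R : ℝ → ℝ → ℝ) (hR : Measurable (Function.uncurry R))
    (κ : ℝ) (M d : ℝ) (hM : 0 < M) (hd : 0 < d)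
    (hband : ∀ s : ℝ, 0 ≤ s → ∀ x : ℝ,
      |R s x - κ| ≤ M * (1 + x ^ 2) / (d + Real.exp (s ^ 5)))
    (φ : ℝ → ℝ) (hφc : Continuous φ) (hφb : ∃ B : ℝ, ∀ t : ℝ, |φ t| ≤ B)
    (Φ : ℝ)
    (hΦ : Tendsto (fun T : ℝ => (1 / T) * ∫ s in (0:ℝ)..T, (φ s) ^ 2)
      atTop (nhds Φ)) :
    ∀ᵐ ω ∂P, Tendsto (fun T : ℝ =>
        (1 / T) * ∫ s in (0:ℝ)..T, (φ s) ^ 2 * R s (X s ω))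
      atTop (nhds (Φ * κ)) := by
  obtain ⟨B, hB⟩ := hφb
  have hsq : ∀ t, |φ t ^ 2| ≤ B ^ 2 := fun t => by
    rw [abs_pow]
    exact pow_le_pow_left₀ (abs_nonneg _) (hB t) 2
  filter_upwards [ae_integrableOn_ratio_sub_center P hX hXint hX2 hR hM hd hband] with ω hω
  exact tendsto_weighted_average_of_integrableOn_sub (hφc.pow 2) hsq hω hΦ
end

section
/- Cauchy–Schwarz inequality for the limiting information constants (Lemma 4 of the paper): under the stated assumptions, Φ₀₁ · κ̄ ≤ √( Φ₀ Φ₁ ) · √( κ₀ κ₁ ). -/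
open Filter MeasureTheory

/-- **Cauchy–Schwarz inequality** for interval integrals of continuous real functions. -/
theorem intervalIntegral_mul_sq_le_of_continuous {f g : ℝ → ℝ} (hf : Continuous f)
    (hg : Continuous g) {a b : ℝ} (hab : a ≤ b) :
    (∫ s in a..b, f s * g s) ^ 2 ≤ (∫ s in a..b, f s ^ 2) * ∫ s in a..b, g s ^ 2 := by
  have key : ∀ t : ℝ, 0 ≤ (∫ s in a..b, f s ^ 2) * (t * t) +
      (2 * ∫ s in a..b, f s * g s) * t + ∫ s in a..b, g s ^ 2 := by
    intro t
    have h : 0 ≤ ∫ s in a..b, (t * f s + g s) ^ 2 :=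
      intervalIntegral.integral_nonneg hab fun s _ => sq_nonneg _
    have e : ∀ s, (t * f s + g s) ^ 2 =
        (t * t) * f s ^ 2 + (2 * t) * (f s * g s) + g s ^ 2 := fun s => by ring
    simp_rw [e] at h
    rw [intervalIntegral.integral_add (Continuous.intervalIntegrable (by fun_prop) _ _)
        (Continuous.intervalIntegrable (by fun_prop) _ _),
      intervalIntegral.integral_add (Continuous.intervalIntegrable (by fun_prop) _ _)
        (Continuous.intervalIntegrable (by fun_prop) _ _),
      intervalIntegral.integral_const_mul, intervalIntegral.integral_const_mul] at h
    linarith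
  have := discrim_le_zero key
  rw [discrim] at this
  linarith

/-- A function within `c / (d + exp (s ^ 5))` of `κ` for all `s ≥ 0` tends to `κ`. -/
theorem tendsto_of_abs_sub_le_div_add_exp {r : ℝ → ℝ} {κ c d : ℝ}
    (h : ∀ s : ℝ, 0 ≤ s → |r s - κ| ≤ c / (d + Real.exp (s ^ 5))) :
    Tendsto r atTop (nhds κ) := by
  have hexp : Tendsto (fun s : ℝ => d + Real.exp (s ^ 5)) atTop atTop :=
    tendsto_atTop_add_const_left _ _
      (Real.tendsto_exp_atTop.comp (tendsto_pow_atTop (by norm_num)))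
  rw [tendsto_iff_norm_sub_tendsto_zero]
  refine squeeze_zero' (Eventually.of_forall fun _ => norm_nonneg _) ?_
    (hexp.const_div_atTop c)
  filter_upwards [eventually_ge_atTop 0] with s hs using h s hs

/-- Lemma 4 of the paper: Cauchy–Schwarz inequality for the limiting
information constants: Φ₀₁ · κ̄ ≤ √(Φ₀ Φ₁) · √(κ₀ κ₁). -/
theorem limiting_information_constants_cauchy_schwarz
    {Ω : Type*} [MeasurableSpace Ω] (P : Measure Ω) [IsProbabilityMeasure P]
    (X : ℝ → Ω → ℝ) (hX : Measurable (Function.uncurry X))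
    (C : ℝ) (hC : 0 < C)
    (hXint : ∀ s : ℝ, 0 ≤ s → Integrable (fun ω => (X s ω) ^ 2) P)
    (hX2 : ∀ s : ℝ, 0 ≤ s → (∫ ω, (X s ω) ^ 2 ∂P) ≤ C * Real.exp (s ^ 3))
    (R₀ R₁ Rbar : ℝ → ℝ → ℝ)
    (hR₀ : Measurable (Function.uncurry R₀)) (hR₁ : Measurable (Function.uncurry R₁))
    (hRbar : Measurable (Function.uncurry Rbar))
    (hR₀pos : ∀ s x : ℝ, 0 ≤ R₀ s x) (hR₁pos : ∀ s x : ℝ, 0 ≤ R₁ s x)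
    (hCS : ∀ s x : ℝ, (Rbar s x) ^ 2 ≤ R₀ s x * R₁ s x)
    (κ₀ κ₁ κbar : ℝ) (hκ₀ : 0 < κ₀) (hκ₁ : 0 < κ₁)
    (M d : ℝ) (hM : 0 < M) (hd : 0 < d)
    (hband₀ : ∀ s : ℝ, 0 ≤ s → ∀ x : ℝ,
      |R₀ s x - κ₀| ≤ M * (1 + x ^ 2) / (d + Real.exp (s ^ 5)))
    (hband₁ : ∀ s : ℝ, 0 ≤ s → ∀ x : ℝ,
      |R₁ s x - κ₁| ≤ M * (1 + x ^ 2) / (d + Real.exp (s ^ 5)))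
    (hbandbar : ∀ s : ℝ, 0 ≤ s → ∀ x : ℝ,
      |Rbar s x - κbar| ≤ M * (1 + x ^ 2) / (d + Real.exp (s ^ 5)))
    (φ₀ φ₁ : ℝ → ℝ) (hφ₀c : Continuous φ₀) (hφ₁c : Continuous φ₁)
    (hφ₀b : ∃ B : ℝ, ∀ t : ℝ, |φ₀ t| ≤ B) (hφ₁b : ∃ B : ℝ, ∀ t : ℝ, |φ₁ t| ≤ B)
    (Φ₀ Φ₁ Φ01 : ℝ)
    (hΦ₀ : Tendsto (fun T : ℝ => (1 / T) * ∫ s in (0:ℝ)..T, (φ₀ s) ^ 2)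
      atTop (nhds Φ₀))
    (hΦ₁ : Tendsto (fun T : ℝ => (1 / T) * ∫ s in (0:ℝ)..T, (φ₁ s) ^ 2)
      atTop (nhds Φ₁))
    (hΦ01 : Tendsto (fun T : ℝ => (1 / T) * ∫ s in (0:ℝ)..T, φ₀ s * φ₁ s)
      atTop (nhds Φ01)) :
    Φ01 * κbar ≤ Real.sqrt (Φ₀ * Φ₁) * Real.sqrt (κ₀ * κ₁) := by
  have hκ : κbar ^ 2 ≤ κ₀ * κ₁ :=
    le_of_tendsto_of_tendsto'
      ((tendsto_of_abs_sub_le_div_add_exp fun s hs => hbandbar s hs 0).pow 2)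
      ((tendsto_of_abs_sub_le_div_add_exp fun s hs => hband₀ s hs 0).mul
        (tendsto_of_abs_sub_le_div_add_exp fun s hs => hband₁ s hs 0))
      fun s => hCS s 0
  have hΦ : Φ01 ^ 2 ≤ Φ₀ * Φ₁ := by
    refine le_of_tendsto_of_tendsto (hΦ01.pow 2) (hΦ₀.mul hΦ₁) ?_
    filter_upwards [eventually_ge_atTop 0] with T hT
    rw [mul_pow, mul_mul_mul_comm, ← sq (1 / T)]
    exact mul_le_mul_of_nonneg_left
      (intervalIntegral_mul_sq_le_of_continuous hφ₀c hφ₁c hT) (sq_nonneg _)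
  calc Φ01 * κbar ≤ |Φ01 * κbar| := le_abs_self _
    _ = |Φ01| * |κbar| := abs_mul _ _
    _ ≤ Real.sqrt (Φ₀ * Φ₁) * Real.sqrt (κ₀ * κ₁) :=
      mul_le_mul (Real.abs_le_sqrt hΦ) (Real.abs_le_sqrt hκ) (abs_nonneg _) (Real.sqrt_nonneg _)
end
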